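/- arXiv:2605.09669 — 2 statements merged into one kernel-verified Lean document; each statement's English description precedes it below -/
import Mathlib

section
/- Let ν ∈ (0,1), R, S, T > 0, and set U = (R − 2ST + S)/(2R). Then det( A(ν,θ;R,S,T,U) − e^{−Iνθ}·Id ) = O(θ³) as θ → 0, i.e., the principal eigenvalue of A agrees with e^{−Iνθ} to second order in θ. -/
open Complex Matrix

/-- The amplification matrix of the parameterized Active Flux scheme. -/
noncomputable def ampMatrix (ν θ R S T U : ℝ) : Matrix (Fin 2) (Fin 2) ℂ :=
  !![1 - (ν : ℂ) * (1 + (1 - (ν : ℂ)) * ((U : ℂ) - (T : ℂ))) *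
        (1 - Complex.exp (-Complex.I * (θ : ℂ))),
      (ν : ℂ) * (1 - (ν : ℂ)) * ((U : ℂ) * Complex.exp (-Complex.I * (θ : ℂ)) - (T : ℂ)) *
        (1 - Complex.exp (-Complex.I * (θ : ℂ)));
      (ν : ℂ) * (1 - (ν : ℂ)) * ((R : ℂ) + (S : ℂ)),
      (1 - (ν : ℂ)) * (1 - (ν : ℂ) * (R : ℂ)) +
        (ν : ℂ) * (1 - (1 - (ν : ℂ)) * (S : ℂ)) * Complex.exp (-Complex.I * (θ : ℂ))]

open Asymptotics Filter Topology in
theorem exp_mul_ofReal_sub_quadratic_isBigO (c : ℂ) :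
    (fun θ : ℝ => Complex.exp (c * θ) - (1 + c * θ + (c * θ) ^ 2 / 2))
      =O[𝓝 0] fun θ : ℝ => θ ^ 3 := by
  have hlim : Tendsto (fun θ : ℝ => c * (θ : ℂ)) (𝓝 0) (𝓝 0) := by
    have h : Continuous fun θ : ℝ => c * (θ : ℂ) := by fun_prop
    simpa using h.tendsto 0
  have h := (Complex.exp_sub_sum_range_isBigO_pow 3).comp_tendsto hlim
  have hpow : (fun θ : ℝ => (c * (θ : ℂ)) ^ 3) =O[𝓝 0] fun θ : ℝ => θ ^ 3 := by
    refine IsBigO.of_bound (‖c‖ ^ 3) (Eventually.of_forall fun θ => ?_)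
    simp [mul_pow]
  refine (h.trans hpow).congr_left fun θ => ?_
  simp [Finset.sum_range_succ]

/-- The characteristic determinant of the amplification matrix at `q`, with `E` in place of
`exp (-I θ)`, expanded around the quadratic Taylor polynomials of `E` and `q`. -/
theorem ampMatrix_charDet_expansion {ν R S T U z E q : ℂ}
    (hU : 2 * R * U = R - 2 * S * T + S) :
    (1 - ν * (1 + (1 - ν) * (U - T)) * (1 - E) - q) *
          ((1 - ν) * (1 - ν * R) + ν * (1 - (1 - ν) * S) * E - q) -
        ν * (1 - ν) * (U * E - T) * (1 - E) * (ν * (1 - ν) * (R + S)) =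
      (E - (1 + z + z ^ 2 / 2)) *
          (ν * (1 + (1 - ν) * (U - T)) *
              ((1 - ν) * (1 - ν * R) + ν * (1 - (1 - ν) * S) * E - q) +
            ν * (1 - (1 - ν) * S) *
              (ν * (1 - ν) * ((U - T) * z + (1 + U - T) / 2 * z ^ 2)) +
            (ν * (1 - ν)) ^ 2 * (R + S) * (U * (E + (1 + z + z ^ 2 / 2)) - T - U)) +
        (q - (1 + ν * z + (ν * z) ^ 2 / 2)) *
          (-((1 - ν) * (1 - ν * R) + ν * (1 - (1 - ν) * S) * E - q +
            ν * (1 - ν) * ((U - T) * z + (1 + U - T) / 2 * z ^ 2))) +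
        z ^ 3 *
          (ν * (1 - ν) * ((U - T) * ((ν * (1 - (1 - ν) * S) - ν ^ 2) / 2) -
              ν * (1 - ν) * S * ((1 + U - T) / 2) +
              (1 + U - T) / 2 * ((ν * (1 - (1 - ν) * S) - ν ^ 2) / 2) * z) +
            (ν * (1 - ν)) ^ 2 * (R + S) * (U + U * z / 4)) := by
  linear_combination (ν * (1 - ν)) ^ 2 * z ^ 2 / 2 * hU

theorem det_ampMatrix_sub_smul_one (ν θ R S T U : ℝ) (q : ℂ) :
    (ampMatrix ν θ R S T U - q • (1 : Matrix (Fin 2) (Fin 2) ℂ)).det =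
      (1 - ν * (1 + (1 - ν) * (U - T)) * (1 - Complex.exp (-Complex.I * θ)) - q) *
          ((1 - ν) * (1 - ν * R) +
            ν * (1 - (1 - ν) * S) * Complex.exp (-Complex.I * θ) - q) -
        ν * (1 - ν) * (U * Complex.exp (-Complex.I * θ) - T) *
          (1 - Complex.exp (-Complex.I * θ)) * (ν * (1 - ν) * (R + S)) := by
  simp [ampMatrix, Matrix.det_fin_two]

open Asymptotics Filter Topology in
theorem principal_eigenvalue_second_order_correct (ν R S T : ℝ)
    (hν : ν ∈ Set.Ioo (0 : ℝ) 1) (hR : 0 < R) (hS : 0 < S) (hT : 0 < T) :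
    (fun θ : ℝ => Matrix.det (ampMatrix ν θ R S T ((R - 2 * S * T + S) / (2 * R)) -
        Complex.exp (-Complex.I * (ν : ℂ) * (θ : ℂ)) • (1 : Matrix (Fin 2) (Fin 2) ℂ)))
      =O[𝓝 0] fun θ : ℝ => θ ^ 3 := by
  have hU : 2 * (R : ℂ) * (((R - 2 * S * T + S) / (2 * R) : ℝ) : ℂ) = R - 2 * S * T + S := by
    have hR' : (R : ℂ) ≠ 0 := by exact_mod_cast hR.ne'
    push_cast
    field_simp
  generalize (R - 2 * S * T + S) / (2 * R) = U at hU ⊢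
  have bigO_mul_continuous {f g : ℝ → ℂ} (hf : f =O[𝓝 0] fun θ : ℝ => θ ^ 3)
      (hg : Continuous g) : (fun θ => f θ * g θ) =O[𝓝 0] fun θ : ℝ => θ ^ 3 := by
    simpa using hf.mul ((hg.tendsto 0).isBigO_one ℝ)
  have hE := exp_mul_ofReal_sub_quadratic_isBigO (-Complex.I)
  have hq := exp_mul_ofReal_sub_quadratic_isBigO (-Complex.I * ν)
  have hz : (fun θ : ℝ => (-Complex.I * (θ : ℂ)) ^ 3) =O[𝓝 0] fun θ : ℝ => θ ^ 3 := by
    refine IsBigO.of_bound 1 (Eventually.of_forall fun θ => ?_)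
    simp
  have hq' : (fun θ : ℝ => Complex.exp (-Complex.I * ν * θ) -
      (1 + ν * (-Complex.I * θ) + (ν * (-Complex.I * θ)) ^ 2 / 2))
        =O[𝓝 0] fun θ : ℝ => θ ^ 3 :=
    hq.congr_left fun θ => by ring
  have hdet (θ : ℝ) := (det_ampMatrix_sub_smul_one ν θ R S T U
    (Complex.exp (-Complex.I * ν * θ))).trans
      (ampMatrix_charDet_expansion (z := -Complex.I * θ) hU)
  simp_rw [hdet]
  refine ((bigO_mul_continuous hE ?_).add (bigO_mul_continuous hq' ?_)).add
    (bigO_mul_continuous hz ?_)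
  all_goals fun_prop
end

section
/- Let ν ∈ (0,1), R > 0, and set S = 18/(−ν² + ν + 2) − R, T = (1/18)·( 9 − (ν+1)·R·((ν−2)·R + 6) ), and U = (1/18)·( −(ν−2)(ν+1)·R² − 6(ν+4)·R + 9(ν−14)/(ν−2) ). Then there exist ε > 0, C > 0 and a function λ₁ : (−ε,ε) → ℂ such that for all θ ∈ (−ε,ε), λ₁(θ) is an eigenvalue of A(ν,θ;R,S,T,U) and | λ₁(θ) − e^{−Iνθ} − (I·ν/540)·( 2ν⁴ − 5ν³ + 5ν − 2 )·θ⁵ | ≤ C·|θ|⁶. In particular, the fifth-order error coefficient does not depend on R. -/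
open Complex Matrix

open Asymptotics Filter Topology

/-- A monic complex quadratic has a root whose distance to `μ` is controlled by the residual at `μ`
divided by the derivative at `μ`. -/
lemma exists_quadratic_root_near (t d μ : ℂ) :
    ∃ l : ℂ, l ^ 2 - t * l + d = 0 ∧
      ‖l - μ‖ * ‖2 * μ - t‖ ≤ 2 * ‖μ ^ 2 - t * μ + d‖ := by
  obtain ⟨s, hs⟩ := IsAlgClosed.exists_pow_nat_eq (t ^ 2 - 4 * d) (n := 2) (by norm_num)
  have key : ∀ u v : ℂ, (μ - u) * (μ - v) = μ ^ 2 - t * μ + d → (μ - u) + (μ - v) = 2 * μ - t →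
      ‖μ - u‖ ≤ ‖μ - v‖ → ‖u - μ‖ * ‖2 * μ - t‖ ≤ 2 * ‖μ ^ 2 - t * μ + d‖ := by
    intro u v hp hs huv
    rw [← hp, ← hs, norm_mul, norm_sub_rev u μ]
    have h := norm_add_le (μ - u) (μ - v)
    nlinarith [norm_nonneg (μ - u), norm_nonneg (μ - v)]
  rcases le_total ‖μ - (t + s) / 2‖ ‖μ - (t - s) / 2‖ with h | h
  · refine ⟨(t + s) / 2, by linear_combination hs / 4, key _ _ ?_ (by ring) h⟩
    linear_combination -hs / 4
  · refine ⟨(t - s) / 2, by linear_combination hs / 4, key _ _ ?_ (by ring) h⟩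
    linear_combination -hs / 4

lemma exp_const_mul_sub_sum_isBigO (k : ℂ) (n : ℕ) :
    (fun x : ℂ => exp (k * x) - ∑ j ∈ Finset.range n, (k * x) ^ j / (j.factorial : ℂ))
      =O[𝓝 0] fun x : ℂ => x ^ n := by
  have hk : Tendsto (fun x : ℂ => k * x) (𝓝 0) (𝓝 0) := by
    simpa using (continuous_const_mul k).tendsto 0
  refine ((exp_sub_sum_range_isBigO_pow n).comp_tendsto hk).trans ?_
  simp only [Function.comp_def, mul_pow]
  exact (isBigO_refl _ _).const_mul_left _

/-- Order conditions under which `exp (ν x) + c x ^ 5` solves, up to `O(x ^ 6)`, a monic quadratic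
equation whose coefficients are polynomials in `exp x`. -/
lemma quadratic_exp_residual_isBigO (ν c a₀ a₁ a₂ b₀ b₁ : ℂ)
    (h₀ : a₀ + a₁ + a₂ + b₀ + b₁ + 1 = 0)
    (hlow : ∀ j ∈ Finset.Icc 1 4, a₁ + a₂ * 2 ^ j + b₀ * ν ^ j + b₁ * (1 + ν) ^ j + (2 * ν) ^ j = 0)
    (hfive : a₁ + a₂ * 2 ^ 5 + b₀ * ν ^ 5 + b₁ * (1 + ν) ^ 5 + (2 * ν) ^ 5
      + 120 * c * (2 + b₀ + b₁) = 0) :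
    (fun x : ℂ => (exp (ν * x) + c * x ^ 5) ^ 2 + (b₀ + b₁ * exp x) * (exp (ν * x) + c * x ^ 5)
      + (a₀ + a₁ * exp x + a₂ * exp x ^ 2)) =O[𝓝 0] fun x : ℂ => x ^ 6 := by
  have e := fun k => exp_const_mul_sub_sum_isBigO k 6
  have s₁ : (fun x : ℂ => exp (1 * x) - 1) =O[𝓝 0] fun x : ℂ => x := by
    simpa using exp_const_mul_sub_sum_isBigO 1 1
  have sν : (fun x : ℂ => exp (ν * x) - 1) =O[𝓝 0] fun x : ℂ => x := by
    simpa using exp_const_mul_sub_sum_isBigO ν 1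
  have x5 : (fun x : ℂ => x ^ 5) =O[𝓝 0] fun x : ℂ => x ^ 5 := isBigO_refl _ _
  have cross : (fun x : ℂ => c * (x ^ 5 * (2 * (exp (ν * x) - 1) + b₁ * (exp (1 * x) - 1))))
      =O[𝓝 0] fun x : ℂ => x ^ 6 := by
    have := (x5.mul ((sν.const_mul_left 2).add (s₁.const_mul_left b₁))).const_mul_left c
    simpa only [← pow_succ] using this
  have tail : (fun x : ℂ => c ^ 2 * x ^ 10) =O[𝓝 0] fun x : ℂ => x ^ 6 := by
    have := (((continuous_pow 4).tendsto (0 : ℂ)).isBigO_one ℂ).mul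
      (isBigO_refl (fun x : ℂ => x ^ 6) (𝓝 0))
    simp only [one_mul, ← pow_add] at this
    exact this.const_mul_left _
  have main := ((((((e 1).const_mul_left a₁).add ((e 2).const_mul_left a₂)).add
    ((e ν).const_mul_left b₀)).add ((e (1 + ν)).const_mul_left b₁)).add (e (2 * ν))).add cross
    |>.add tail
  refine main.congr_left fun x => ?_
  have h₁ := hlow 1 (by simp)
  have h₂ := hlow 2 (by simp)
  have h₃ := hlow 3 (by simp)
  have h₄ := hlow 4 (by simp)
  have z₂ : exp (2 * x) = exp x ^ 2 := by rw [← exp_nat_mul]; norm_num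
  have w₂ : exp (2 * ν * x) = exp (ν * x) ^ 2 := by rw [← exp_nat_mul]; push_cast; ring_nf
  have zw : exp ((1 + ν) * x) = exp x * exp (ν * x) := by rw [← exp_add]; ring_nf
  rw [z₂, w₂, zw]
  simp only [Finset.sum_range_succ, Finset.sum_range_zero, Nat.factorial, one_mul]
  push_cast
  linear_combination -h₀ - x * h₁ - x ^ 2 / 2 * h₂ - x ^ 3 / 6 * h₃ - x ^ 4 / 24 * h₄
    - x ^ 5 / 120 * hfive

theorem principal_eigenvalue_error_fourth_order (ν R : ℝ)
    (hν : ν ∈ Set.Ioo (0 : ℝ) 1) (hR : 0 < R) :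
    ∃ ε > (0 : ℝ), ∃ C > (0 : ℝ), ∃ lam : ℝ → ℂ,
      ∀ θ ∈ Set.Ioo (-ε) ε,
        Matrix.det (ampMatrix ν θ R
            (18 / (-ν ^ 2 + ν + 2) - R)
            ((1 / 18) * (9 - (ν + 1) * R * ((ν - 2) * R + 6)))
            ((1 / 18) * (-((ν - 2) * (ν + 1) * R ^ 2) - 6 * (ν + 4) * R +
              9 * (ν - 14) / (ν - 2))) -
          lam θ • (1 : Matrix (Fin 2) (Fin 2) ℂ)) = 0 ∧
        ‖lam θ - Complex.exp (-Complex.I * (ν : ℂ) * (θ : ℂ)) -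
            (Complex.I * (ν : ℂ) / 540) *
              ((2 * (ν : ℂ) ^ 4 - 5 * (ν : ℂ) ^ 3 + 5 * (ν : ℂ) - 2)) * (θ : ℂ) ^ 5‖
          ≤ C * |θ| ^ 6 := by
  obtain ⟨hν₀, hν₁⟩ := hν
  set S : ℝ := 18 / (-ν ^ 2 + ν + 2) - R with hS
  set T : ℝ := (1 / 18) * (9 - (ν + 1) * R * ((ν - 2) * R + 6)) with hT
  set U : ℝ := (1 / 18) * (-((ν - 2) * (ν + 1) * R ^ 2) - 6 * (ν + 4) * R +
    9 * (ν - 14) / (ν - 2)) with hU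
  set c : ℝ := -(ν / 540 * (2 * ν ^ 4 - 5 * ν ^ 3 + 5 * ν - 2)) with hc
  have hν₂ : ν - 2 ≠ 0 := by linarith
  have hν₃ : ν + 1 ≠ 0 := by linarith
  have hS' : S = -18 / ((ν - 2) * (ν + 1)) - R := by
    rw [hS, show -ν ^ 2 + ν + 2 = -((ν - 2) * (ν + 1)) by ring, div_neg, neg_div]
  set α : ℝ := ν * (1 + (1 - ν) * (U - T)) with hα
  set g : ℝ := (1 - ν) * (1 - ν * R) with hg
  set h : ℝ := ν * (1 - (1 - ν) * S) with hh
  set δ : ℝ := (ν * (1 - ν)) ^ 2 * (R + S) with hδ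
  set a₀ : ℝ := (1 - α) * g + δ * T with ha₀
  set a₁ : ℝ := (1 - α) * h + α * g - δ * (U + T) with ha₁
  set a₂ : ℝ := α * h + δ * U with ha₂
  set b₀ : ℝ := -(1 - α + g) with hb₀
  set b₁ : ℝ := -(α + h) with hb₁
  have hκ : 2 + b₀ + b₁ ≠ 0 := by
    have : 2 + b₀ + b₁ = ν * (1 - ν) * (18 / ((2 - ν) * (ν + 1))) := by
      have : 2 - ν ≠ 0 := by linarith
      rw [hb₀, hb₁, hg, hh, hS']
      field_simp
      ring
    rw [this]
    have h₁ : 0 < 1 - ν := by linarith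
    have h₂ : 0 < 2 - ν := by linarith
    positivity
  have hres := quadratic_exp_residual_isBigO ν c a₀ a₁ a₂ b₀ b₁
    (by norm_cast; simp only [ha₀, ha₁, ha₂, hb₀, hb₁, hg, hh, hδ]; ring)
    (by
      intro j hj
      norm_cast
      rw [ha₁, ha₂, hb₀, hb₁, hα, hg, hh, hδ, hS', hT, hU]
      fin_cases hj <;> field_simp <;> ring)
    (by
      norm_cast
      rw [ha₁, ha₂, hb₀, hb₁, hα, hg, hh, hδ, hc, hS', hT, hU]
      field_simp
      ring)
  have hI : Tendsto (fun θ : ℝ => -I * (θ : ℂ)) (𝓝 0) (𝓝 0) := by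
    have : Continuous fun θ : ℝ => -I * (θ : ℂ) := by fun_prop
    simpa using this.tendsto 0
  obtain ⟨K, hK, hbound⟩ := (hres.comp_tendsto hI).exists_pos
  set μ : ℝ → ℂ := fun θ => exp (ν * (-I * θ)) + c * (-I * θ) ^ 5 with hμ
  set t : ℝ → ℂ := fun θ => -(b₀ + b₁ * exp (-I * θ)) with ht
  set d : ℝ → ℂ := fun θ => a₀ + a₁ * exp (-I * θ) + a₂ * exp (-I * θ) ^ 2 with hd
  have hcont : Continuous fun θ : ℝ => ‖2 * μ θ - t θ‖ := by fun_prop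
  have hκ' : 0 < ‖(2 + b₀ + b₁ : ℂ)‖ := norm_pos_iff.2 (by exact_mod_cast hκ)
  set m : ℝ := ‖(2 + b₀ + b₁ : ℂ)‖ with hm
  have hzero : ‖2 * μ 0 - t 0‖ = m := by
    rw [hm]; simp [hμ, ht]; ring_nf
  have hlt : ∀ᶠ θ in 𝓝 (0 : ℝ), m / 2 < ‖2 * μ θ - t θ‖ :=
    hcont.continuousAt.eventually (lt_mem_nhds (hzero.symm ▸ by linarith : m / 2 < ‖2 * μ 0 - t 0‖))
  obtain ⟨ε, hε, hball⟩ := Metric.eventually_nhds_iff.1 (hbound.bound.and hlt)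
  choose lam hroot hnear using fun θ => exists_quadratic_root_near (t θ) (d θ) (μ θ)
  refine ⟨ε, hε, 4 * K / m, by positivity, lam, fun θ hθ => ⟨?_, ?_⟩⟩
  · rw [← hroot θ, Matrix.det_fin_two]
    simp only [ampMatrix, ht, hd, ha₀, ha₁, ha₂, hb₀, hb₁, hα, hg, hh, hδ, Matrix.sub_apply,
      Matrix.smul_apply, Matrix.of_apply, Matrix.cons_val', Matrix.cons_val_zero,
      Matrix.cons_val_one, Matrix.cons_val_fin_one, Matrix.one_apply_eq, smul_eq_mul, ne_eq,
      zero_ne_one, one_ne_zero, not_false_eq_true, Matrix.one_apply_ne]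
    push_cast
    ring
  · obtain ⟨hb, hl⟩ := hball (show dist θ 0 < ε by
      rw [Real.dist_eq, sub_zero]; exact abs_lt.2 hθ)
    have hexp : exp (-I * ν * θ) + I * ν / 540 * (2 * ν ^ 4 - 5 * ν ^ 3 + 5 * ν - 2) * θ ^ 5
        = μ θ := by
      have h5 : (-I : ℂ) ^ 5 = -I := by
        rw [show (-I : ℂ) ^ 5 = -(I ^ 2 * I ^ 2 * I) by ring, I_sq]; ring
      simp only [hμ, hc, mul_pow, h5]
      push_cast
      ring_nf
    rw [sub_sub, hexp]
    have hb' : ‖μ θ ^ 2 - t θ * μ θ + d θ‖ ≤ K * |θ| ^ 6 := by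
      simpa [hμ, ht, hd, -neg_add_rev] using hb
    have hn := hnear θ
    rw [div_mul_eq_mul_div, le_div_iff₀ hκ']
    nlinarith [norm_nonneg (lam θ - μ θ)]
end
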